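/- Let A be a locally (ρ, σ, β)-bounded injection pattern with ρ ≤ 1 and β(i) ≤ B for all i, on the single-destination path of size n, and let L be a load configuration realized at some round of an execution of the OED protocol on A. If I is a plateau of even height h in L, then L_h(I) = Σ_{i ∈ I} (L(i) − h) ≤ |I| + σ + Σ_{i ∈ I} β(i) ≤ (B + 1)|I| + σ. -/

import Mathlib

/-- Injection patterns on the single-destination path of size `n` inject only into
buffers `1, …, n`. -/
def pathSupp (n : ℕ) (a : ℕ → ℕ → ℕ) : Prop :=
  ∀ t i, i ∉ Finset.Icc 1 n → a t i = 0

/-- The injection pattern `a` on the single-destination path of size `n` is locally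
`(ρ, σ, β)`-bounded. -/
def LBPath (n : ℕ) (a : ℕ → ℕ → ℕ) (ρ σ : ℝ) (β : ℕ → ℝ) : Prop :=
  ∀ s t : ℕ, ∀ S ⊆ Finset.Icc 1 n, ∀ e ∈ Finset.Icc 1 n,
    ((∑ r ∈ Finset.Icc s t, ∑ i ∈ S.filter (fun i => i ≤ e), a r i : ℕ) : ℝ)
      ≤ ρ * (Finset.Icc s t).card + σ + ∑ i ∈ S, β i

/-- The injection pattern `a` on the single-destination path of size `n` is
`(ρ, σ)`-bounded. -/
def BPath (n : ℕ) (a : ℕ → ℕ → ℕ) (ρ σ : ℝ) : Prop :=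
  ∀ s t : ℕ, ∀ e ∈ Finset.Icc 1 n,
    ((∑ r ∈ Finset.Icc s t, ∑ i ∈ (Finset.Icc 1 n).filter (fun i => i ≤ e), a r i : ℕ) : ℝ)
      ≤ ρ * (Finset.Icc s t).card + σ

/-- The Odd-Even Downhill forwarding decision for buffer `i` given the load
configuration `L` (with the convention `L (n+1) = 0`): buffer `i ∈ {1, …, n}` forwards
iff `L i > L (i+1)`, or `L i = L (i+1)` and `L i` is odd. -/
def oedF (n : ℕ) (L : ℕ → ℕ) (i : ℕ) : ℕ :=
  if 1 ≤ i ∧ i ≤ n ∧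
      ((if i + 1 ≤ n then L (i + 1) else 0) < L i ∨
        (L i = (if i + 1 ≤ n then L (i + 1) else 0) ∧ Odd (L i)))
  then 1 else 0

/-- The loads of the OED protocol running on the injection pattern `a`:
`oedL n a t i` is the load of buffer `i` at round `t` after injections, with
`L(0, i) = 0` and `L(t+1, i) = L(t, i) − F(t, i) + F(t, i−1) + a(t+1, i)`. -/
def oedL (n : ℕ) (a : ℕ → ℕ → ℕ) : ℕ → ℕ → ℕ
  | 0 => fun _ => 0
  | t + 1 => fun i =>
      oedL n a t i - oedF n (oedL n a t) i + oedF n (oedL n a t) (i - 1) + a (t + 1) i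

/-- `[p, q] ⊆ {1, …, n}` is a plateau of height `h` for the configuration `L`:
every buffer of `[p, q]` has load at least `h`, and `[p, q]` is maximal with this
property. -/
def IsPlateau (n : ℕ) (L : ℕ → ℕ) (h p q : ℕ) : Prop :=
  1 ≤ p ∧ p ≤ q ∧ q ≤ n ∧ (∀ i ∈ Finset.Icc p q, h ≤ L i) ∧
    (p = 1 ∨ L (p - 1) < h) ∧ (q = n ∨ L (q + 1) < h)

theorem oedF_eq_one_iff (n : ℕ) (L : ℕ → ℕ) (i : ℕ) :
    oedF n L i = 1 ↔ 1 ≤ i ∧ i ≤ n ∧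
      ((if i + 1 ≤ n then L (i + 1) else 0) < L i ∨
        (L i = (if i + 1 ≤ n then L (i + 1) else 0) ∧ Odd (L i))) := by
  rw [oedF, ite_eq_left_iff]
  simp only [zero_ne_one, imp_false, not_not]

theorem oedF_le_one (n : ℕ) (L : ℕ → ℕ) (i : ℕ) : oedF n L i ≤ 1 := by
  unfold oedF; split_ifs <;> simp

theorem oedF_le_load (n : ℕ) (L : ℕ → ℕ) (i : ℕ) : oedF n L i ≤ L i := by
  unfold oedF
  split_ifs with h1 h2 <;> grind

/-- The number of packets that buffer `i` forwards from above height `h`. -/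
def oedOut (n : ℕ) (L : ℕ → ℕ) (h i : ℕ) : ℕ := if h < L i then oedF n L i else 0

/-- The part of the load of a buffer above an even height changes, before injections, by at most
the flow of packets above that height. -/
theorem forward_sub_add_oedOut_le {n : ℕ} (L : ℕ → ℕ) {h : ℕ} (hh : Even h) {i : ℕ}
    (hi : 1 ≤ i) (hin : i ≤ n) :
    (L i - oedF n L i + oedF n L (i - 1) - h) + oedOut n L h i
      ≤ (L i - h) + oedOut n L h (i - 1) := by
  have h1 := oedF_le_one n L i
  have h2 := oedF_le_one n L (i - 1)
  have h3 := oedF_le_load n L i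
  have h4 : oedF n L (i - 1) = 1 → L i < L (i - 1) ∨ (L (i - 1) = L i ∧ Odd (L i)) := by
    rw [oedF_eq_one_iff, Nat.sub_add_cancel hi, if_pos hin]
    grind
  unfold oedOut
  rcases Nat.lt_trichotomy (oedF n L (i - 1)) 1 with h5 | h5 | h5
  · split_ifs <;> omega
  · rcases h4 h5 with h6 | ⟨h6, h7⟩
    · split_ifs <;> omega
    · have : L i ≠ h := by
        rintro rfl
        exact (Nat.not_odd_iff_even.2 hh) h7
      split_ifs <;> omega
  · omega

theorem sum_forward_sub_add_oedOut_le {n : ℕ} (L : ℕ → ℕ) {h : ℕ} (hh : Even h) {p d : ℕ}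
    (hp : 1 ≤ p) (hpd : p ≤ d) (hd : d ≤ n) :
    (∑ i ∈ Finset.Icc p d, (L i - oedF n L i + oedF n L (i - 1) - h)) + oedOut n L h d
      ≤ (∑ i ∈ Finset.Icc p d, (L i - h)) + oedOut n L h (p - 1) := by
  induction d, hpd using Nat.le_induction with
  | base => simpa using forward_sub_add_oedOut_le L hh hp hd
  | succ d hpd ih =>
    have h1 := ih (by omega)
    have h2 := forward_sub_add_oedOut_le (n := n) L hh (i := d + 1) (by omega) hd
    rw [Finset.sum_Icc_succ_top (by omega), Finset.sum_Icc_succ_top (by omega)]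
    simp only [Nat.add_sub_cancel] at h2 ⊢
    omega

/-- On an interval whose left neighbour has load less than the even height `h` and whose right
neighbour has load at most `h`, the number of packets above height `h` is bounded by the size of
the interval plus the excess of the injections over one packet per round, during some final
segment of rounds. -/
theorem exists_sum_load_sub_le (n : ℕ) (a : ℕ → ℕ → ℕ) {h : ℕ} (hh : Even h) (t : ℕ) :
    ∀ p d : ℕ, 1 ≤ p → p ≤ d → d ≤ n → (p = 1 ∨ oedL n a t (p - 1) < h) →
      (d = n ∨ oedL n a t (d + 1) ≤ h) →
      ∃ s ≤ t + 1, (∑ i ∈ Finset.Icc p d, (oedL n a t i - h)) + (t + 1 - s)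
        ≤ (d + 1 - p) + ∑ r ∈ Finset.Icc s t, ∑ i ∈ Finset.Icc p d, a r i := by
  induction t with
  | zero =>
    intro p d _ _ _ _ _
    exact ⟨1, le_rfl, by simp [oedL]⟩
  | succ t ih =>
    intro p d hp hpd hdn hleft hright
    have hstep : ∀ i, oedL n a (t + 1) i = oedL n a t i - oedF n (oedL n a t) i
        + oedF n (oedL n a t) (i - 1) + a (t + 1) i := fun _ => rfl
    have hE : (∑ i ∈ Finset.Icc p d, (oedL n a (t + 1) i - h))
        ≤ (∑ i ∈ Finset.Icc p d, (oedL n a t i - oedF n (oedL n a t) i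
            + oedF n (oedL n a t) (i - 1) - h)) + ∑ i ∈ Finset.Icc p d, a (t + 1) i := by
      rw [← Finset.sum_add_distrib]
      refine Finset.sum_le_sum fun i _ => ?_
      rw [hstep]
      omega
    simp only [hstep] at hleft hright
    generalize oedL n a t = L at *
    have hflow := sum_forward_sub_add_oedOut_le (n := n) L hh hp hpd hdn
    have hin : oedOut n L h (p - 1) = 0 := by
      unfold oedOut
      split_ifs with hlt
      · rcases hleft with rfl | hleft
        · simp [oedF]
        · have := oedF_le_one n L (p - 1)
          omega
      · rfl
    by_cases hex : ∃ i ∈ Finset.Icc p d, h < L i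
    · obtain ⟨e, he, hemax⟩ := Finset.exists_max_image
        ((Finset.Icc p d).filter (fun i => h < L i)) id (by
          obtain ⟨i, hi, hhi⟩ := hex
          exact ⟨i, Finset.mem_filter.2 ⟨hi, hhi⟩⟩)
      simp only [Finset.mem_filter, Finset.mem_Icc, id] at he hemax
      obtain ⟨⟨hpe, hed⟩, hLe⟩ := he
      have hright' : e = n ∨ L (e + 1) ≤ h := by
        by_contra! hcon
        obtain ⟨hen, hL⟩ := hcon
        rcases hed.lt_or_eq with hlt | rfl
        · have := hemax (e + 1) ⟨⟨by omega, by omega⟩, hL⟩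
          omega
        · have h1 := oedF_le_one n L (e + 1)
          have h2 : oedF n L e ≠ 1 := by simp at hright; omega
          rw [Ne, oedF_eq_one_iff, if_pos (by omega)] at h2
          have h3 : L (e + 1) = h + 1 := by omega
          have h4 : Odd (L (e + 1)) := h3 ▸ hh.add_one
          apply h2
          refine ⟨by omega, by omega, ?_⟩
          rcases (show L (e + 1) < L e ∨ L e = L (e + 1) by omega) with h5 | h5
          · exact Or.inl h5
          · exact Or.inr ⟨h5, h5 ▸ h4⟩
      obtain ⟨c, hpc, hce, hc, hclow⟩ : ∃ c, p ≤ c ∧ c ≤ e ∧ (c = 1 ∨ L (c - 1) < h) ∧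
          ∀ i ∈ Finset.Icc p d, i < c → L i ≤ h := by
        by_cases hcp : p = 1 ∨ L (p - 1) < h
        · exact ⟨p, le_rfl, hpe, hcp, fun i hi hic => by
            have := (Finset.mem_Icc.1 hi).1
            omega⟩
        · push Not at hcp
          have h1 := oedF_le_one n L (p - 1)
          have h2 : oedF n L (p - 1) = 1 := by omega
          have h3 : L (p - 1) = h := by omega
          rw [oedF_eq_one_iff, Nat.sub_add_cancel hp, if_pos (by omega), h3] at h2
          have h4 : L p < h := by
            rcases h2.2.2 with h4 | ⟨_, h4⟩
            · exact h4
            · exact absurd hh (Nat.not_even_iff_odd.2 h4)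
          refine ⟨p + 1, by omega, ?_, Or.inr (by simpa using h4), fun i hi hic => ?_⟩
          · rcases hpe.lt_or_eq with h5 | rfl <;> omega
          · have := (Finset.mem_Icc.1 hi).1
            obtain rfl : i = p := by omega
            exact h4.le
      obtain ⟨s, hs, hbound⟩ := ih c e (by omega) hce (by omega) hc hright'
      have hsub : Finset.Icc c e ⊆ Finset.Icc p d := Finset.Icc_subset_Icc hpc hed
      have hsum : ∑ i ∈ Finset.Icc c e, (L i - h) = ∑ i ∈ Finset.Icc p d, (L i - h) := by
        refine Finset.sum_subset hsub fun i hi hni => ?_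
        by_contra hne
        have hi' := Finset.mem_Icc.1 hi
        by_cases hic : i < c
        · have := hclow i hi hic
          omega
        · have := hemax i ⟨hi', by omega⟩
          exact hni (Finset.mem_Icc.2 ⟨by omega, this⟩)
      have hinj : ∑ r ∈ Finset.Icc s t, ∑ i ∈ Finset.Icc c e, a r i
          ≤ ∑ r ∈ Finset.Icc s t, ∑ i ∈ Finset.Icc p d, a r i :=
        Finset.sum_le_sum fun r _ => Finset.sum_le_sum_of_subset hsub
      have hout : e = d → oedOut n L h d = 1 := by
        rintro rfl
        rw [oedOut, if_pos hLe, oedF_eq_one_iff]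
        refine ⟨by omega, by omega, Or.inl ?_⟩
        split_ifs <;> omega
      refine ⟨s, by omega, ?_⟩
      rw [Finset.sum_Icc_succ_top (by omega)]
      by_cases hed' : e = d
      · have := hout hed'
        omega
      · omega
    · push Not at hex
      have hzero : ∑ i ∈ Finset.Icc p d, (L i - h) = 0 :=
        Finset.sum_eq_zero fun i hi => Nat.sub_eq_zero_of_le (hex i hi)
      refine ⟨t + 1, by omega, ?_⟩
      simp only [Finset.Icc_self, Finset.sum_singleton]
      omega

/-- for a locally `(ρ, σ, β)`-bounded injection pattern with `ρ ≤ 1` and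
`β(i) ≤ B`, in any configuration realized by OED forwarding, the number of packets
above an even plateau `I` of height `h` is at most
`|I| + σ + ∑_{i ∈ I} β i ≤ (B+1)|I| + σ`. -/
theorem stmt9 (n : ℕ) (a : ℕ → ℕ → ℕ) (ρ σ B : ℝ) (β : ℕ → ℝ)
    (hρ : ρ ≤ 1) (hσ : 0 ≤ σ) (hβ0 : ∀ i, 0 ≤ β i) (hβB : ∀ i, β i ≤ B)
    (hsupp : pathSupp n a) (hA : LBPath n a ρ σ β)
    (t h p q : ℕ) (hh : Even h) (hpl : IsPlateau n (oedL n a t) h p q) :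
    ((∑ i ∈ Finset.Icc p q, (oedL n a t i - h) : ℕ) : ℝ)
        ≤ (Finset.Icc p q).card + σ + ∑ i ∈ Finset.Icc p q, β i ∧
      ((Finset.Icc p q).card : ℝ) + σ + ∑ i ∈ Finset.Icc p q, β i
        ≤ (B + 1) * (Finset.Icc p q).card + σ := by
  obtain ⟨hp, hpq, hqn, -, hleft, hright⟩ := hpl
  constructor
  · obtain ⟨s, hs, hbound⟩ := exists_sum_load_sub_le n a hh t p q hp hpq hqn hleft
      (hright.imp_right le_of_lt)
    have hinj := hA s t (Finset.Icc p q) (Finset.Icc_subset_Icc hp hqn) q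
      (Finset.mem_Icc.2 ⟨by omega, hqn⟩)
    rw [Finset.filter_true_of_mem fun i hi => (Finset.mem_Icc.1 hi).2] at hinj
    rw [← Nat.card_Icc, ← Nat.card_Icc] at hbound
    have hbound' : ((∑ i ∈ Finset.Icc p q, (oedL n a t i - h) : ℕ) : ℝ)
        + ((Finset.Icc s t).card : ℝ) ≤ ((Finset.Icc p q).card : ℝ)
        + ((∑ r ∈ Finset.Icc s t, ∑ i ∈ Finset.Icc p q, a r i : ℕ) : ℝ) := by
      exact_mod_cast hbound
    have hρT : ρ * ((Finset.Icc s t).card : ℝ) ≤ (Finset.Icc s t).card :=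
      mul_le_of_le_one_left (Nat.cast_nonneg _) hρ
    linarith
  · have hsum := Finset.sum_le_card_nsmul (Finset.Icc p q) β B fun i _ => hβB i
    rw [nsmul_eq_mul] at hsum
    linarith
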